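/- arXiv:2503.10138 — 7 statements merged into one kernel-verified Lean document; each statement's English description precedes it below -/
import Mathlib

section
/- Let f : ℝⁿ → ℝ be a convex L-smooth function (L > 0), let η ∈ (0, 1.75/L], and let (x_k) be the gradient descent iterates x_{k+1} = x_k - η • ∇f(x_k) from an arbitrary x_0 ∈ ℝⁿ. Then the sequence of decrements k ↦ f(x_k) - f(x_{k+1}) is non-increasing; i.e., for every k, f(x_{k+2}) - f(x_{k+1}) ≥ f(x_{k+1}) - f(x_k). Equivalently, the optimization curve k ↦ f(x_k) is convex over the non-negative integers. -/
section SmoothConvex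

variable {E : Type*} [NormedAddCommGroup E] [InnerProductSpace ℝ E] [CompleteSpace E] {f : E → ℝ}

theorem hasDerivAt_comp_add_smul_of_differentiable (hf : Differentiable ℝ f) (x d : E)
    (t : ℝ) : HasDerivAt (fun s : ℝ => f (x + s • d)) (inner ℝ (gradient f (x + t • d)) d) t := by
  have hline : HasDerivAt (fun s : ℝ => x + s • d) d t := by
    simpa using ((hasDerivAt_id t).smul_const d).const_add x
  rw [inner_gradient_left]
  exact (hf (x + t • d)).hasFDerivAt.comp_hasDerivAt t hline

/-- The first-order characterization of convexity. -/
theorem ConvexOn.add_inner_gradient_le (hconv : ConvexOn ℝ Set.univ f) (hf : Differentiable ℝ f)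
    (x y : E) : f x + inner ℝ (gradient f x) (y - x) ≤ f y := by
  have hg : ConvexOn ℝ Set.univ (fun s : ℝ => f (x + s • (y - x))) := by
    simpa [Function.comp_def, AffineMap.lineMap_apply, add_comm] using
      hconv.comp_affineMap (AffineMap.lineMap x y : ℝ →ᵃ[ℝ] E)
  have hderiv := hasDerivAt_comp_add_smul_of_differentiable hf x (y - x) 0
  have h := hg.le_slope_of_hasDerivAt (Set.mem_univ 0) (Set.mem_univ 1) one_pos hderiv
  simp [slope_def_field, -inner_gradient_left] at h
  linarith

/-- The descent lemma. -/
theorem LipschitzWith.le_add_inner_gradient_add_sq {K : NNReal} (hf : Differentiable ℝ f)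
    (hlip : LipschitzWith K (gradient f)) (x d : E) :
    f (x + d) ≤ f x + inner ℝ (gradient f x) d + K / 2 * ‖d‖ ^ 2 := by
  have hderiv (t : ℝ) : HasDerivAt
      (fun s : ℝ => f (x + s • d) - s * inner ℝ (gradient f x) d - K / 2 * ‖d‖ ^ 2 * s ^ 2)
      (inner ℝ (gradient f (x + t • d)) d - inner ℝ (gradient f x) d - K * ‖d‖ ^ 2 * t) t := by
    refine (((hasDerivAt_comp_add_smul_of_differentiable hf x d t).sub
      ((hasDerivAt_id t).mul_const (inner ℝ (gradient f x) d))).sub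
      ((hasDerivAt_pow 2 t).const_mul (K / 2 * ‖d‖ ^ 2))).congr_deriv ?_
    norm_num
    ring
  have hanti := antitoneOn_of_deriv_nonpos (convex_Icc (0 : ℝ) 1)
    (fun t _ => (hderiv t).continuousAt.continuousWithinAt)
    (fun t _ => (hderiv t).differentiableAt.differentiableWithinAt) (by
      intro t ht
      rw [interior_Icc] at ht
      rw [(hderiv t).deriv, ← inner_sub_left]
      have hdist := hlip.dist_le_mul (x + t • d) x
      rw [dist_eq_norm, dist_eq_norm, add_sub_cancel_left, norm_smul,
        Real.norm_of_nonneg ht.1.le] at hdist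
      have hinner := real_inner_le_norm (gradient f (x + t • d) - gradient f x) d
      have hmul := mul_le_mul_of_nonneg_right hdist (norm_nonneg d)
      linarith)
  have h := hanti (Set.left_mem_Icc.2 zero_le_one) (Set.right_mem_Icc.2 zero_le_one) zero_le_one
  simp [-inner_gradient_left] at h
  linarith

/-- The interpolation inequality for smooth convex functions. -/
theorem ConvexOn.add_inner_gradient_add_sq_le {K : NNReal} (hK : 0 < K)
    (hconv : ConvexOn ℝ Set.univ f) (hf : Differentiable ℝ f)
    (hlip : LipschitzWith K (gradient f)) (x y : E) :
    f x + inner ℝ (gradient f x) (y - x) + 1 / (2 * K) * ‖gradient f y - gradient f x‖ ^ 2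
      ≤ f y := by
  have hK' : (K : ℝ) ≠ 0 := by exact_mod_cast hK.ne'
  set v := gradient f y - gradient f x with hv
  have hlower := hconv.add_inner_gradient_le hf x (y + (-(K : ℝ)⁻¹) • v)
  have hupper := hlip.le_add_inner_gradient_add_sq hf y ((-(K : ℝ)⁻¹) • v)
  rw [add_sub_right_comm, inner_add_right, inner_smul_right] at hlower
  rw [inner_smul_right, norm_smul, norm_neg, norm_inv, Real.norm_of_nonneg K.coe_nonneg,
    mul_pow] at hupper
  have hvv : inner ℝ (gradient f y) v - inner ℝ (gradient f x) v = ‖v‖ ^ 2 := by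
    rw [← inner_sub_left, ← hv, real_inner_self_eq_norm_sq]
  have hcoef : (K : ℝ) / 2 * ((K : ℝ)⁻¹ ^ 2 * ‖v‖ ^ 2) = (K : ℝ)⁻¹ * ‖v‖ ^ 2 / 2 := by
    field_simp
  have hcoef' : 1 / (2 * (K : ℝ)) * ‖v‖ ^ 2 = (K : ℝ)⁻¹ * ‖v‖ ^ 2 / 2 := by
    field_simp
  have hmul := congrArg ((K : ℝ)⁻¹ * ·) hvv
  simp only [mul_sub] at hmul
  linarith

end SmoothConvex

/-- For a convex `L`-smooth `f` and step size `η ∈ (0, 1.75/L]`, the sequence of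
decrements `k ↦ f (x k) - f (x (k+1))` of gradient descent is non-increasing,
i.e. the optimization curve is convex. -/
theorem gradientDescent_curve_convex
    {n : ℕ} (f : EuclideanSpace ℝ (Fin n) → ℝ) (L : ℝ) (hL : 0 < L)
    (hconv : ConvexOn ℝ Set.univ f) (hdiff : Differentiable ℝ f)
    (hlip : LipschitzWith L.toNNReal (gradient f))
    (η : ℝ) (hη : η ∈ Set.Ioc 0 (1.75 / L))
    (x : ℕ → EuclideanSpace ℝ (Fin n))
    (hx : ∀ k : ℕ, x (k + 1) = x k - η • gradient f (x k)) :
    ∀ k : ℕ, f (x (k + 1)) - f (x (k + 2)) ≤ f (x k) - f (x (k + 1)) := by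
  intro k
  obtain ⟨hη0, hηL⟩ := hη
  have hstep : 2 / 7 * η ≤ 1 / (2 * (L.toNNReal : ℝ)) := by
    rw [Real.coe_toNNReal L hL.le]
    rw [le_div_iff₀ hL] at hηL
    rw [le_div_iff₀ (by positivity)]
    linarith
  have hinterp (i j : ℕ) : f (x i) + inner ℝ (gradient f (x i)) (x j - x i)
      + 2 / 7 * η * ‖gradient f (x j) - gradient f (x i)‖ ^ 2 ≤ f (x j) := by
    have h := hconv.add_inner_gradient_add_sq_le (Real.toNNReal_pos.2 hL) hdiff hlip (x i) (x j)
    have hmul := mul_le_mul_of_nonneg_right hstep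
      (sq_nonneg ‖gradient f (x j) - gradient f (x i)‖)
    linarith
  have h01 := hinterp (k + 1) k
  have h21 := hinterp (k + 1) (k + 2)
  have h20 := hinterp k (k + 2)
  set a := gradient f (x k)
  set b := gradient f (x (k + 1))
  set c := gradient f (x (k + 2))
  have hd01 : x k - x (k + 1) = η • a := by rw [hx k]; abel
  have hd21 : x (k + 2) - x (k + 1) = -(η • b) := by rw [hx (k + 1)]; abel
  have hd20 : x (k + 2) - x k = -(η • a) - η • b := by
    rw [← sub_add_sub_cancel (x (k + 2)) (x (k + 1)) (x k), hd21, ← neg_sub (x k), hd01]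
    abel
  rw [hd01] at h01
  rw [hd21] at h21
  rw [hd20] at h20
  have hsq : 0 ≤ η * ‖a + b - (2 : ℝ) • c‖ ^ 2 := by positivity
  simp only [← real_inner_self_eq_norm_sq, inner_sub_left, inner_sub_right, inner_add_left,
    inner_add_right, inner_neg_right, inner_smul_left, inner_smul_right, real_inner_comm a b,
    real_inner_comm a c, real_inner_comm b c, conj_trivial] at h01 h21 h20 hsq
  linarith
end

section
/- For every L > 0 there exist a convex L-smooth function f : ℝ → ℝ and an initial point x_0 ∈ ℝ such that for every step size η ∈ (1.75/L, 2/L), the gradient descent iterates x_{k+1} = x_k - η · f'(x_k) starting from x_0 satisfy f(x_0) - f(x_1) < f(x_1) - f(x_2); in particular the optimization curve k ↦ f(x_k) is not convex. -/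
lemma hasDerivAt_of_abs_sub_le_sq {f : ℝ → ℝ} {d x C : ℝ}
    (h : ∀ y, |f y - f x - (y - x) * d| ≤ C * (y - x) ^ 2) : HasDerivAt f d x := by
  rw [hasDerivAt_iff_isLittleO]
  refine Asymptotics.IsBigO.trans_isLittleO (g := fun y => ‖y - x‖ ^ 2) ?_
    (Asymptotics.isLittleO_pow_sub_sub x one_lt_two)
  refine Asymptotics.IsBigO.of_bound C (Filter.Eventually.of_forall fun y => ?_)
  simpa [abs_of_nonneg (sq_nonneg (y - x))] using h y

/-- The function with derivative `x ↦ L * max x (-c)`: quadratic on `[-c, ∞)`, affine to the left. -/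
noncomputable def halfHuber (L c x : ℝ) : ℝ :=
  L * (x ^ 2 / 2 - (min (x + c) 0) ^ 2 / 2)

lemma hasDerivAt_halfHuber (L c x : ℝ) : HasDerivAt (halfHuber L c) (L * max x (-c)) x := by
  unfold halfHuber
  refine HasDerivAt.const_mul L (hasDerivAt_of_abs_sub_le_sq (C := 1) fun y => ?_)
  rw [abs_le]
  rcases le_total (x + c) 0 with hx | hx <;> rcases le_total (y + c) 0 with hy | hy
  · rw [min_eq_left hx, min_eq_left hy, max_eq_right (by linarith)]
    constructor <;> nlinarith [sq_nonneg (y - x)]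
  · rw [min_eq_left hx, min_eq_right hy, max_eq_right (by linarith)]
    constructor <;> nlinarith [sq_nonneg (y - x), mul_nonneg hy (neg_nonneg.2 hx)]
  · rw [min_eq_right hx, min_eq_left hy, max_eq_left (by linarith)]
    constructor <;> nlinarith [sq_nonneg (y - x), mul_nonneg hx (neg_nonneg.2 hy)]
  · rw [min_eq_right hx, min_eq_right hy, max_eq_left (by linarith)]
    constructor <;> nlinarith [sq_nonneg (y - x)]

lemma deriv_halfHuber (L c : ℝ) : deriv (halfHuber L c) = fun x => L * max x (-c) :=
  funext fun x => (hasDerivAt_halfHuber L c x).deriv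

lemma differentiable_halfHuber (L c : ℝ) : Differentiable ℝ (halfHuber L c) :=
  fun x => (hasDerivAt_halfHuber L c x).differentiableAt

lemma convexOn_halfHuber {L : ℝ} (hL : 0 ≤ L) (c : ℝ) :
    ConvexOn ℝ Set.univ (halfHuber L c) := by
  refine Monotone.convexOn_univ_of_deriv (differentiable_halfHuber L c) ?_
  rw [deriv_halfHuber]
  exact fun x y hxy => mul_le_mul_of_nonneg_left (max_le_max_right _ hxy) hL

lemma lipschitzWith_deriv_halfHuber {L : ℝ} (hL : 0 ≤ L) (c : ℝ) :
    LipschitzWith L.toNNReal (deriv (halfHuber L c)) := by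
  refine LipschitzWith.of_dist_le_mul fun x y => ?_
  rw [deriv_halfHuber, Real.coe_toNNReal L hL, Real.dist_eq, Real.dist_eq, ← mul_sub, abs_mul,
    abs_of_nonneg hL]
  exact mul_le_mul_of_nonneg_left (abs_max_sub_max_le_abs x y (-c)) hL

/-- For every `L > 0` there exist a convex `L`-smooth function `f : ℝ → ℝ` and an
initial point `x₀` such that for every step size `η ∈ (1.75/L, 2/L)`, the gradient
descent iterates satisfy `f x₀ - f x₁ < f x₁ - f x₂`; in particular the
optimization curve is not convex. -/
theorem exists_nonconvex_curve (L : ℝ) (hL : 0 < L) :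
    ∃ (f : ℝ → ℝ) (x₀ : ℝ), ConvexOn ℝ Set.univ f ∧ Differentiable ℝ f ∧
      LipschitzWith L.toNNReal (deriv f) ∧
      ∀ η ∈ Set.Ioo (1.75 / L) (2 / L),
        ∀ x : ℕ → ℝ, x 0 = x₀ → (∀ k : ℕ, x (k + 1) = x k - η * deriv f (x k)) →
          f (x 0) - f (x 1) < f (x 1) - f (x 2) := by
  refine ⟨halfHuber L (5 / 9), 1, convexOn_halfHuber hL.le _, differentiable_halfHuber L _,
    lipschitzWith_deriv_halfHuber hL.le _, ?_⟩
  rintro η ⟨h1, h2⟩ x hx0 hx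
  rw [div_lt_iff₀ hL] at h1
  rw [lt_div_iff₀ hL] at h2
  obtain ⟨t, ht⟩ : ∃ t, t = η * L := ⟨_, rfl⟩
  rw [← ht] at h1 h2
  norm_num at h1
  have hx1 : x 1 = 1 - t := by
    rw [hx 0, deriv_halfHuber, hx0, ht]
    norm_num
  have hx2 : x 2 = 1 - 4 / 9 * t := by
    rw [hx 1, deriv_halfHuber, hx1]
    dsimp only
    rw [max_eq_right (by linarith), ← mul_assoc, ← ht]
    ring
  rw [hx0, hx1, hx2]
  unfold halfHuber
  rw [min_eq_right (by norm_num), min_eq_left (by linarith), min_eq_right (by linarith),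
    ← mul_sub, ← mul_sub]
  refine mul_lt_mul_of_pos_left ?_ hL
  nlinarith
end

section
/- Define f : ℝ → ℝ by f(t) = t²/2 for t ≤ 1 and f(t) = t - 1/2 for t > 1. Then: (a) f is convex; (b) f is differentiable with 1-Lipschitz derivative (f is 1-smooth); and (c) for every η ∈ (1.75, 2), starting gradient descent at x_0 = -1.8, the iterates satisfy x_1 = 1.8(η - 1) > 1, x_2 = -1.8 + 0.8η < 1, and f(x_0) - f(x_1) < f(x_1) - f(x_2). -/
theorem hasDerivAt_of_quadratic_then_linear
    {f : ℝ → ℝ} (hf : ∀ t : ℝ, f t = if t ≤ 1 then t ^ 2 / 2 else t - 1 / 2) (x : ℝ) :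
    HasDerivAt f (min x 1) x := by
  have hquad (y : ℝ) : HasDerivAt (fun t : ℝ => t ^ 2 / 2) y y := by
    simpa using (hasDerivAt_pow 2 y).div_const 2
  have hlin (y : ℝ) : HasDerivAt (fun t : ℝ => t - 1 / 2) 1 y :=
    (hasDerivAt_id y).sub_const _
  have hleft {y : ℝ} (hy : y ≤ 1) : f y = y ^ 2 / 2 := by simp [hf, hy]
  have hright {y : ℝ} (hy : 1 ≤ y) : f y = y - 1 / 2 := by
    rcases hy.eq_or_lt with rfl | hy
    · norm_num [hf]
    · simp [hf, hy.not_ge]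
  rcases lt_trichotomy x 1 with hx | rfl | hx
  · rw [min_eq_left hx.le]
    refine (hquad x).congr_of_eventuallyEq ?_
    filter_upwards [Iio_mem_nhds hx] with y hy using hleft (le_of_lt hy)
  · rw [min_self, ← hasDerivWithinAt_univ, ← Set.Iic_union_Ici (a := (1 : ℝ))]
    exact ((hquad 1).hasDerivWithinAt.congr (fun _ hy => hleft hy) (hleft le_rfl)).union
      ((hlin 1).hasDerivWithinAt.congr (fun _ hy => hright hy) (hright le_rfl))
  · rw [min_eq_right hx.le]
    refine (hlin x).congr_of_eventuallyEq ?_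
    filter_upwards [Ioi_mem_nhds hx] with y hy using hright (le_of_lt hy)

/-- The explicit counterexample: `f t = t²/2` for `t ≤ 1`, `f t = t - 1/2` for `t > 1`,
is convex and `1`-smooth, and for every `η ∈ (1.75, 2)`, gradient descent from
`x₀ = -1.8` satisfies `x₁ = 1.8(η-1) > 1`, `x₂ = -1.8 + 0.8η < 1` and
`f x₀ - f x₁ < f x₁ - f x₂`. -/
theorem explicit_counterexample
    (f : ℝ → ℝ) (hf : ∀ t : ℝ, f t = if t ≤ 1 then t ^ 2 / 2 else t - 1 / 2) :
    ConvexOn ℝ Set.univ f ∧ Differentiable ℝ f ∧ LipschitzWith 1 (deriv f) ∧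
      ∀ η ∈ Set.Ioo (1.75 : ℝ) 2,
        ∀ x₀ x₁ x₂ : ℝ, x₀ = -1.8 → x₁ = x₀ - η * deriv f x₀ → x₂ = x₁ - η * deriv f x₁ →
          x₁ = 1.8 * (η - 1) ∧ 1 < x₁ ∧ x₂ = -1.8 + 0.8 * η ∧ x₂ < 1 ∧
            f x₀ - f x₁ < f x₁ - f x₂ := by
  have hd := hasDerivAt_of_quadratic_then_linear hf
  have hderiv : deriv f = fun x => min x 1 := funext fun x => (hd x).deriv
  have hdiff : Differentiable ℝ f := fun x => (hd x).differentiableAt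
  refine ⟨Monotone.convexOn_univ_of_deriv hdiff ?_, hdiff, ?_, ?_⟩
  · rw [hderiv]
    exact fun a b hab => min_le_min_right 1 hab
  · rw [hderiv]
    exact LipschitzWith.id.min_const 1
  · rintro η ⟨hη, hη'⟩ x₀ x₁ x₂ h₀ h₁ h₂
    norm_num at hη
    have e₀ : deriv f x₀ = -1.8 := by
      rw [(hd x₀).deriv, h₀]
      norm_num
    have e₁ : x₁ = 1.8 * (η - 1) := by
      rw [h₁, e₀, h₀]
      ring
    have hx₁ : 1 < x₁ := by
      rw [e₁]
      linarith
    have e₂ : x₂ = -1.8 + 0.8 * η := by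
      rw [h₂, (hd x₁).deriv, min_eq_right hx₁.le, e₁]
      ring
    have hx₂ : x₂ < 1 := by
      rw [e₂]
      linarith
    refine ⟨e₁, hx₁, e₂, hx₂, ?_⟩
    rw [hf x₀, hf x₁, hf x₂, if_pos (by rw [h₀]; norm_num), if_neg hx₁.not_ge, if_pos hx₂.le,
      h₀, e₁, e₂]
    nlinarith [mul_pos (sub_pos.2 hη) (sub_pos.2 hη')]
end

section
/- Let f : ℝⁿ → ℝ be a convex function of class C², let x_0 ∈ ℝⁿ, and let x : ℝ → ℝⁿ be a solution of the gradient flow equation: x(0) = x_0 and for every t ≥ 0, x'(t) = -∇f(x(t)). Then the optimization curve g : [0,∞) → ℝ defined by g(t) = f(x(t)) is convex on [0,∞). -/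
/-- The gradient of a `C²` function is differentiable. -/
theorem ContDiff.differentiable_gradient {F : Type*} [NormedAddCommGroup F]
    [InnerProductSpace ℝ F] [CompleteSpace F] {f : F → ℝ} (hf : ContDiff ℝ 2 f) :
    Differentiable ℝ (gradient f) := by
  have h : Differentiable ℝ (fderiv ℝ f) :=
    (hf.fderiv_right (m := 1) (by norm_num)).differentiable (by norm_num)
  exact (InnerProductSpace.toDual ℝ F).symm.toContinuousLinearEquiv.differentiable.comp h

/-- The Hessian of a convex `C²` function is positive semidefinite. -/
theorem ConvexOn.inner_fderiv_gradient_nonneg {F : Type*} [NormedAddCommGroup F]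
    [InnerProductSpace ℝ F] [CompleteSpace F] {f : F → ℝ} (hconv : ConvexOn ℝ Set.univ f)
    (hf : ContDiff ℝ 2 f) (y v : F) :
    0 ≤ inner ℝ (fderiv ℝ (gradient f) y v) v := by
  have hline : ∀ s : ℝ, HasDerivAt (fun s : ℝ => y + s • v) v s := fun s => by
    simpa using ((hasDerivAt_id s).smul_const v).const_add y
  have hd : ∀ s : ℝ,
      HasDerivAt (fun s : ℝ => f (y + s • v)) (inner ℝ (gradient f (y + s • v)) v) s := fun s => by
    have h := (hf.differentiable (by norm_num) (y + s • v)).hasGradientAt.hasFDerivAt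
    simpa [Function.comp_def] using h.comp_hasDerivAt s (hline s)
  have hc : ConvexOn ℝ Set.univ (fun s : ℝ => f (y + s • v)) := by
    have h := hconv.comp_affineMap (AffineMap.lineMap y (y + v))
    have e : f ∘ (AffineMap.lineMap y (y + v) : ℝ →ᵃ[ℝ] F) = fun s : ℝ => f (y + s • v) := by
      ext s
      simp [AffineMap.lineMap_apply, add_comm]
    rwa [e, Set.preimage_univ] at h
  have hmono : Monotone (fun s : ℝ => (inner ℝ (gradient f (y + s • v)) v : ℝ)) := by
    have h := hc.monotoneOn_deriv (fun s _ => (hd s).differentiableAt)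
    rw [monotoneOn_univ] at h
    convert h using 1
    ext s
    exact (hd s).deriv.symm
  have hG : HasDerivAt (fun s : ℝ => (inner ℝ (gradient f (y + s • v)) v : ℝ))
      (inner ℝ (fderiv ℝ (gradient f) y v) v) 0 := by
    have h := (hf.differentiable_gradient (y + (0 : ℝ) • v)).hasFDerivAt.comp_hasDerivAt 0 (hline 0)
    simpa using h.inner ℝ (hasDerivAt_const 0 v)
  exact hG.deriv ▸ hmono.deriv_nonneg

/-- For a convex `C²` function `f`, the gradient flow optimization curve
`t ↦ f (x t)` is convex on `[0, ∞)`. -/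
theorem gradientFlow_curve_convex_of_contDiff
    {n : ℕ} (f : EuclideanSpace ℝ (Fin n) → ℝ)
    (hconv : ConvexOn ℝ Set.univ f) (hC2 : ContDiff ℝ 2 f)
    (x₀ : EuclideanSpace ℝ (Fin n)) (x : ℝ → EuclideanSpace ℝ (Fin n))
    (hx0 : x 0 = x₀)
    (hflow : ∀ t ∈ Set.Ici (0 : ℝ), HasDerivAt x (-(gradient f (x t))) t) :
    ConvexOn ℝ (Set.Ici (0 : ℝ)) (fun t => f (x t)) := by
  have hg : ∀ t ∈ Set.Ici (0 : ℝ), HasDerivAt (fun t => f (x t))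
      (-(inner ℝ (gradient f (x t)) (gradient f (x t)))) t := fun t ht => by
    have h := (hC2.differentiable (by norm_num) (x t)).hasGradientAt.hasFDerivAt
    refine (h.comp_hasDerivAt t (hflow t ht)).congr_deriv ?_
    rw [map_neg, InnerProductSpace.toDual_apply_apply]
  have hG : ∀ t ∈ Set.Ici (0 : ℝ), HasDerivAt
      (fun t => -(inner ℝ (gradient f (x t)) (gradient f (x t)) : ℝ))
      (2 * inner ℝ (fderiv ℝ (gradient f) (x t) (gradient f (x t))) (gradient f (x t))) t :=
    fun t ht => by
      have h := (hC2.differentiable_gradient (x t)).hasFDerivAt.comp_hasDerivAt t (hflow t ht)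
      refine (h.inner ℝ h).neg.congr_deriv ?_
      simp only [Function.comp_apply, map_neg, inner_neg_left, inner_neg_right]
      rw [real_inner_comm (gradient f (x t))]
      ring
  refine convexOn_of_hasDerivWithinAt2_nonneg (convex_Ici 0)
    (fun t ht => (hg t ht).continuousAt.continuousWithinAt)
    (fun t ht => (hg t (interior_subset ht)).hasDerivWithinAt)
    (fun t ht => (hG t (interior_subset ht)).hasDerivWithinAt) fun t _ => ?_
  exact mul_nonneg zero_le_two (hconv.inner_fderiv_gradient_nonneg hC2 _ _)
end

section
/- Let f : ℝⁿ → ℝ be a convex L-smooth function (L > 0), let x_0 ∈ ℝⁿ, and let x : ℝ → ℝⁿ be a solution of the gradient flow equation: x(0) = x_0 and for every t ≥ 0, x'(t) = -∇f(x(t)). Then the optimization curve t ↦ f(x(t)) is convex on [0,∞). -/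
/-- The gradient of a differentiable convex function is a monotone operator. -/
theorem ConvexOn.inner_gradient_sub_nonneg {E : Type*} [NormedAddCommGroup E]
    [InnerProductSpace ℝ E] [CompleteSpace E] {f : E → ℝ}
    (hconv : ConvexOn ℝ Set.univ f) (hdiff : Differentiable ℝ f) (a b : E) :
    0 ≤ inner ℝ (gradient f b - gradient f a) (b - a) := by
  have hline (s : ℝ) : HasDerivAt (fun r => f (AffineMap.lineMap a b r))
      (inner ℝ (gradient f (AffineMap.lineMap a b s)) (b - a)) s := by
    have hgrad := (hdiff (AffineMap.lineMap a b s)).hasGradientAt.hasFDerivAt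
    exact hgrad.comp_hasDerivAt s AffineMap.hasDerivAt_lineMap
  have hconv_line : ConvexOn ℝ Set.univ (fun r : ℝ => f (AffineMap.lineMap a b r)) :=
    hconv.comp_affineMap (AffineMap.lineMap a b)
  have hmono := hconv_line.monotoneOn_deriv (fun s _ => (hline s).differentiableAt)
    (Set.mem_univ 0) (Set.mem_univ 1) zero_le_one
  rw [(hline 0).deriv, (hline 1).deriv] at hmono
  simp only [AffineMap.lineMap_apply_zero, AffineMap.lineMap_apply_one] at hmono
  rw [inner_sub_left]
  linarith

/-- Two solutions of the gradient flow of a convex function do not move apart. -/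
theorem antitoneOn_norm_sub_of_gradientFlow {E : Type*} [NormedAddCommGroup E]
    [InnerProductSpace ℝ E] [CompleteSpace E] {f : E → ℝ}
    (hconv : ConvexOn ℝ Set.univ f) (hdiff : Differentiable ℝ f) {x y : ℝ → E}
    (hx : ∀ t ∈ Set.Ici (0 : ℝ), HasDerivAt x (-(gradient f (x t))) t)
    (hy : ∀ t ∈ Set.Ici (0 : ℝ), HasDerivAt y (-(gradient f (y t))) t) :
    AntitoneOn (fun t => ‖y t - x t‖) (Set.Ici 0) := by
  have hderiv (t : ℝ) (ht : t ∈ Set.Ici (0 : ℝ)) := ((hy t ht).sub (hx t ht)).norm_sq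
  have hanti : AntitoneOn (fun t => ‖y t - x t‖ ^ 2) (Set.Ici 0) := by
    refine antitoneOn_of_deriv_nonpos (convex_Ici 0)
      (fun t ht => (hderiv t ht).continuousAt.continuousWithinAt)
      (fun t ht => (hderiv t (interior_subset ht)).differentiableAt.differentiableWithinAt)
      fun t ht => ?_
    have hmono := hconv.inner_gradient_sub_nonneg hdiff (x t) (y t)
    refine (hderiv t (interior_subset ht)).deriv.trans_le ?_
    rw [Pi.sub_apply, neg_sub_neg, ← neg_sub (gradient f (y t)), inner_neg_right, real_inner_comm]
    linarith
  exact fun s hs t ht hst => le_of_sq_le_sq (hanti hs ht hst) (norm_nonneg _)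

open scoped Topology in
/-- The gradient norm is nonincreasing along the gradient flow of a convex function. -/
theorem antitoneOn_norm_gradient_of_gradientFlow {E : Type*} [NormedAddCommGroup E]
    [InnerProductSpace ℝ E] [CompleteSpace E] {f : E → ℝ}
    (hconv : ConvexOn ℝ Set.univ f) (hdiff : Differentiable ℝ f) {x : ℝ → E}
    (hx : ∀ t ∈ Set.Ici (0 : ℝ), HasDerivAt x (-(gradient f (x t))) t) :
    AntitoneOn (fun t => ‖gradient f (x t)‖) (Set.Ici 0) := by
  intro s hs t ht hst
  have hlim (r : ℝ) (hr : r ∈ Set.Ici (0 : ℝ)) :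
      Filter.Tendsto (fun h : ℝ => ‖h⁻¹ • (x (r + h) - x r)‖) (𝓝[>] 0)
        (𝓝 ‖gradient f (x r)‖) := by
    simpa using (hx r hr).tendsto_slope_zero_right.norm
  refine le_of_tendsto_of_tendsto (hlim t ht) (hlim s hs) ?_
  filter_upwards [self_mem_nhdsWithin] with h hh
  have hshift (r : ℝ) (hr : r ∈ Set.Ici (0 : ℝ)) :
      HasDerivAt (fun r => x (r + h)) (-(gradient f (x (r + h)))) r :=
    (hx (r + h) (Set.mem_Ici.2 (add_nonneg hr (le_of_lt hh)))).comp_add_const r h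
  rw [norm_smul, norm_smul]
  exact mul_le_mul_of_nonneg_left
    (antitoneOn_norm_sub_of_gradientFlow hconv hdiff hx hshift hs ht hst) (norm_nonneg _)

/-- For a convex `L`-smooth function `f`, the gradient flow optimization curve
`t ↦ f (x t)` is convex on `[0, ∞)`. -/
theorem gradientFlow_curve_convex
    {n : ℕ} (f : EuclideanSpace ℝ (Fin n) → ℝ) (L : ℝ) (hL : 0 < L)
    (hconv : ConvexOn ℝ Set.univ f) (hdiff : Differentiable ℝ f)
    (hlip : LipschitzWith L.toNNReal (gradient f))
    (x₀ : EuclideanSpace ℝ (Fin n)) (x : ℝ → EuclideanSpace ℝ (Fin n))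
    (hx0 : x 0 = x₀)
    (hflow : ∀ t ∈ Set.Ici (0 : ℝ), HasDerivAt x (-(gradient f (x t))) t) :
    ConvexOn ℝ (Set.Ici (0 : ℝ)) (fun t => f (x t)) := by
  have hderiv (t : ℝ) (ht : t ∈ Set.Ici (0 : ℝ)) :
      HasDerivAt (fun t => f (x t)) (-‖gradient f (x t)‖ ^ 2) t := by
    have hgrad := (hdiff (x t)).hasGradientAt.hasFDerivAt
    refine (hgrad.comp_hasDerivAt t (hflow t ht)).congr_deriv ?_
    rw [InnerProductSpace.toDual_apply_apply, inner_neg_right, real_inner_self_eq_norm_sq]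
  refine MonotoneOn.convexOn_of_deriv (convex_Ici 0)
    (fun t ht => (hderiv t ht).continuousAt.continuousWithinAt)
    (fun t ht => (hderiv t (interior_subset ht)).differentiableAt.differentiableWithinAt)
    fun s hs t ht hst => ?_
  rw [(hderiv s (interior_subset hs)).deriv, (hderiv t (interior_subset ht)).deriv]
  exact neg_le_neg (pow_le_pow_left₀ (norm_nonneg _)
    (antitoneOn_norm_gradient_of_gradientFlow hconv hdiff hflow
      (interior_subset hs) (interior_subset ht) hst) 2)
end

section
/- Let f : ℝⁿ → ℝ be a convex L-smooth function (L > 0) and x_0 ∈ ℝⁿ, and let x : ℝ → ℝⁿ be the solution of the gradient flow equation x(0) = x_0, x'(t) = -∇f(x(t)) for t ≥ 0. For η > 0, let (X_k) be the gradient descent iterates X_0 = x_0, X_{k+1} = X_k - η • ∇f(X_k), and let the Euler approximation x^(η) : [0,∞) → ℝⁿ be defined by x^(η)(t) = X_{⌊t/η⌋} - (t - ⌊t/η⌋·η) • ∇f(X_{⌊t/η⌋}). Then for every R > 0, x^(η) converges to x uniformly on [0, R] as η → 0⁺: for every ε > 0 there exists δ > 0 such that for all η ∈ (0, δ) and all t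 ∈ [0, R], ‖x^(η)(t) - x(t)‖ ≤ ε. -/
open Set

section ExplicitEuler

variable {E : Type*} [NormedAddCommGroup E] [NormedSpace ℝ E] {v : E → E} {K : NNReal}
  {x : ℝ → E} {R M : ℝ}

/-- Error propagation for one step of the explicit Euler method, applied to an autonomous ODE with
Lipschitz right-hand side. -/
lemma norm_euler_step_sub_le (hv : LipschitzWith K v)
    (hx : ∀ t ∈ Icc 0 R, HasDerivAt x (v (x t)) t) (hM : ∀ t ∈ Icc 0 R, ‖v (x t)‖ ≤ M)
    {a b : ℝ} (ha : 0 ≤ a) (hab : a ≤ b) (hb : b ≤ R) (y : E) :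
    ‖y + (b - a) • v y - x b‖ ≤ (1 + K * (b - a)) * ‖y - x a‖ + K * M * (b - a) ^ 2 := by
  have hsub {t : ℝ} (ht : t ∈ Icc a b) : t ∈ Icc 0 R := ⟨ha.trans ht.1, ht.2.trans hb⟩
  have hM0 : 0 ≤ M := (norm_nonneg _).trans (hM a (hsub (left_mem_Icc.2 hab)))
  have hmove : ∀ t ∈ Icc a b, ‖x t - x a‖ ≤ M * (t - a) :=
    norm_image_sub_le_of_norm_deriv_le_segment'
      (fun t ht => (hx t (hsub ht)).hasDerivWithinAt)
      (fun t ht => hM t (hsub (Ico_subset_Icc_self ht)))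
  have hderiv : ∀ t ∈ Icc a b,
      HasDerivWithinAt (fun s => y + (s - a) • v y - x s) (v y - v (x t)) (Icc a b) t := by
    intro t ht
    have h₁ : HasDerivAt (fun s : ℝ => y + (s - a) • v y) (v y) t := by
      simpa using (((hasDerivAt_id t).sub_const a).smul_const (v y)).const_add y
    exact (h₁.sub (hx t (hsub ht))).hasDerivWithinAt
  have hbound : ∀ t ∈ Ico a b,
      ‖v y - v (x t)‖ ≤ K * (‖y - x a‖ + M * (b - a)) := by
    intro t ht
    have h₁ : ‖y - x t‖ ≤ ‖y - x a‖ + ‖x t - x a‖ := by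
      simpa [norm_sub_rev] using norm_sub_le_norm_sub_add_norm_sub y (x a) (x t)
    refine (hv.norm_sub_le y (x t)).trans ?_
    gcongr
    have h₂ := hmove t (Ico_subset_Icc_self ht)
    have h₃ : M * (t - a) ≤ M * (b - a) := by gcongr; exact ht.2.le
    linarith
  have hinc := norm_image_sub_le_of_norm_deriv_le_segment' hderiv hbound b (right_mem_Icc.2 hab)
  have htri := norm_le_norm_add_norm_sub (y - x a) (y + (b - a) • v y - x b)
  simp only [sub_self, zero_smul, add_zero] at hinc
  rw [norm_sub_rev (y - x a)] at htri
  linarith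

/-- A global error bound at time `a` propagates along an explicit Euler step of length at most
`η`. -/
lemma norm_euler_step_sub_le_exp (hv : LipschitzWith K v)
    (hx : ∀ t ∈ Icc 0 R, HasDerivAt x (v (x t)) t) (hM : ∀ t ∈ Icc 0 R, ‖v (x t)‖ ≤ M)
    {a b η : ℝ} (ha : 0 ≤ a) (hab : a ≤ b) (hb : b ≤ R) (hη : b - a ≤ η) {y : E}
    (hy : ‖y - x a‖ ≤ K * M * η * a * Real.exp (K * a)) :
    ‖y + (b - a) • v y - x b‖ ≤ K * M * η * b * Real.exp (K * b) := by
  have hM0 : 0 ≤ M := (norm_nonneg _).trans (hM a ⟨ha, hab.trans hb⟩)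
  have hh : 0 ≤ b - a := sub_nonneg.2 hab
  have hη0 : 0 ≤ η := hh.trans hη
  have hexp : 1 + K * (b - a) ≤ Real.exp (K * (b - a)) := by
    linarith [Real.add_one_le_exp (K * (b - a))]
  have hone : 1 ≤ Real.exp (K * b) :=
    Real.one_le_exp (mul_nonneg K.coe_nonneg (ha.trans hab))
  calc ‖y + (b - a) • v y - x b‖
    _ ≤ (1 + K * (b - a)) * ‖y - x a‖ + K * M * (b - a) ^ 2 :=
        norm_euler_step_sub_le hv hx hM ha hab hb y
    _ ≤ Real.exp (K * (b - a)) * (K * M * η * a * Real.exp (K * a))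
          + K * M * (η * (b - a)) * Real.exp (K * b) := by
        refine add_le_add (by gcongr) ?_
        calc K * M * (b - a) ^ 2
          _ ≤ K * M * (η * (b - a)) * 1 := by rw [mul_one, sq]; gcongr
          _ ≤ K * M * (η * (b - a)) * Real.exp (K * b) := by gcongr
    _ = K * M * η * b * Real.exp (K * b) := by
        rw [show K * b = K * (b - a) + K * a by ring, Real.exp_add]
        ring

/-- The piecewise linear explicit Euler approximation of an autonomous ODE with Lipschitz right-hand
side has a global error of first order in the step size. -/
theorem norm_euler_sub_le (hv : LipschitzWith K v)
    (hx : ∀ t ∈ Icc 0 R, HasDerivAt x (v (x t)) t) (hM : ∀ t ∈ Icc 0 R, ‖v (x t)‖ ≤ M)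
    {η : ℝ} (hη : 0 < η) {Y : ℕ → E} (hY0 : Y 0 = x 0) (hYs : ∀ k, Y (k + 1) = Y k + η • v (Y k))
    {t : ℝ} (ht : t ∈ Icc 0 R) :
    ‖Y ⌊t / η⌋₊ + (t - ⌊t / η⌋₊ * η) • v (Y ⌊t / η⌋₊) - x t‖ ≤
      K * M * η * t * Real.exp (K * t) := by
  have hgrid (k : ℕ) (hk : k * η ≤ R) :
      ‖Y k - x (k * η)‖ ≤ K * M * η * (k * η) * Real.exp (K * (k * η)) := by
    induction k with
    | zero => simp [hY0]
    | succ k ih =>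
      have hstep : ((k + 1 : ℕ) : ℝ) * η - k * η = η := by push_cast; ring
      have h := norm_euler_step_sub_le_exp hv hx hM (by positivity) (by linarith) hk hstep.le
        (ih (by linarith))
      rwa [hstep, ← hYs] at h
  have hle : ⌊t / η⌋₊ * η ≤ t :=
    (le_div_iff₀ hη).1 (Nat.floor_le (div_nonneg ht.1 hη.le))
  have hlt : t < (⌊t / η⌋₊ + 1) * η := (div_lt_iff₀ hη).1 (Nat.lt_floor_add_one _)
  exact norm_euler_step_sub_le_exp hv hx hM (by positivity) hle ht.2 (by linarith)
    (hgrid _ (hle.trans ht.2))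

end ExplicitEuler

/-- Uniform convergence of Euler's approximation to the gradient flow on compact
intervals: for a convex `L`-smooth `f`, gradient flow solution `x`, and gradient
descent iterates `X η` with step size `η`, the Euler approximation
`t ↦ X η ⌊t/η⌋₊ - (t - ⌊t/η⌋₊ η) • ∇f (X η ⌊t/η⌋₊)` converges to `x`
uniformly on `[0, R]` as `η → 0⁺`. -/
theorem euler_approx_tendsto_uniformly
    {n : ℕ} (f : EuclideanSpace ℝ (Fin n) → ℝ) (L : ℝ) (hL : 0 < L)
    (hconv : ConvexOn ℝ Set.univ f) (hdiff : Differentiable ℝ f)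
    (hlip : LipschitzWith L.toNNReal (gradient f))
    (x₀ : EuclideanSpace ℝ (Fin n)) (x : ℝ → EuclideanSpace ℝ (Fin n))
    (hx0 : x 0 = x₀)
    (hflow : ∀ t ∈ Set.Ici (0 : ℝ), HasDerivAt x (-(gradient f (x t))) t)
    (X : ℝ → ℕ → EuclideanSpace ℝ (Fin n))
    (hX0 : ∀ η : ℝ, X η 0 = x₀)
    (hXs : ∀ (η : ℝ) (k : ℕ), X η (k + 1) = X η k - η • gradient f (X η k)) :
    ∀ R > (0 : ℝ), ∀ ε > (0 : ℝ), ∃ δ > (0 : ℝ), ∀ η ∈ Set.Ioo (0 : ℝ) δ,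
      ∀ t ∈ Set.Icc (0 : ℝ) R,
        ‖(X η ⌊t / η⌋₊ - (t - (⌊t / η⌋₊ : ℝ) * η) • gradient f (X η ⌊t / η⌋₊)) - x t‖ ≤ ε := by
  intro R hR ε hε
  have hx : ∀ t ∈ Icc 0 R, HasDerivAt x (-(gradient f (x t))) t := fun t ht => hflow t ht.1
  have hcont : ContinuousOn (fun t => -(gradient f (x t))) (Icc 0 R) :=
    (hlip.continuous.comp_continuousOn
      fun t ht => (hx t ht).continuousAt.continuousWithinAt).neg
  obtain ⟨M, hM⟩ := isCompact_Icc.exists_bound_of_continuousOn hcont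
  have hM0 : 0 ≤ M := (norm_nonneg _).trans (hM 0 (left_mem_Icc.2 hR.le))
  set C : ℝ := L.toNNReal * M * R * Real.exp (L.toNNReal * R) with hC
  have hC0 : 0 ≤ C := by positivity
  refine ⟨ε / (C + 1), by positivity, fun η hη t ht => ?_⟩
  have hη0 : 0 < η := hη.1
  have ht0 : 0 ≤ t := ht.1
  have hηC : η * (C + 1) < ε := (lt_div_iff₀ (by positivity)).1 hη.2
  have h := norm_euler_sub_le (v := fun y => -(gradient f y)) hlip.neg hx hM hη0
    ((hX0 η).trans hx0.symm) (fun k => by rw [hXs, smul_neg, sub_eq_add_neg]) ht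
  rw [smul_neg, ← sub_eq_add_neg] at h
  calc _ ≤ _ := h
    _ ≤ L.toNNReal * M * η * R * Real.exp (L.toNNReal * R) := by gcongr <;> exact ht.2
    _ = η * C := by rw [hC]; ring
    _ ≤ ε := by linarith
end

section
/- Let f : ℝⁿ → ℝ be a convex L-smooth function (L > 0) and x_0 ∈ ℝⁿ, and let x : ℝ → ℝⁿ be the solution of the gradient flow equation x(0) = x_0, x'(t) = -∇f(x(t)) for t ≥ 0. For η > 0, define the Euler approximation x^(η)(t) = X_{⌊t/η⌋} - (t - ⌊t/η⌋·η) • ∇f(X_{⌊t/η⌋}), where X_0 = x_0 and X_{k+1} = X_k - η • ∇f(X_k). Then for every t ≥ 0, f(x^(η)(t)) → f(x(t)) as η → 0⁺. -/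
section EulerMethod

variable {E : Type*} [NormedAddCommGroup E] [NormedSpace ℝ E]
  {v : E → E} {K : NNReal} {x : ℝ → E} {T M η : ℝ}

/-- Local truncation error of the Euler method for an autonomous Lipschitz vector field. -/
lemma LipschitzWith.norm_sub_euler_step_le (hv : LipschitzWith K v)
    (hx : ∀ t ∈ Set.Icc 0 T, HasDerivAt x (v (x t)) t)
    (hM : ∀ t ∈ Set.Icc 0 T, ‖v (x t)‖ ≤ M) {a s : ℝ} (ha : 0 ≤ a) (hs : 0 ≤ s)
    (has : a + s ≤ T) :
    ‖x (a + s) - x a - s • v (x a)‖ ≤ K * M * s ^ 2 := by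
  have hsub : Set.Icc a (a + s) ⊆ Set.Icc 0 T := Set.Icc_subset_Icc ha has
  have hM0 : 0 ≤ M := (norm_nonneg _).trans (hM a ⟨ha, by linarith⟩)
  have hleft : a ∈ Set.Icc a (a + s) := ⟨le_rfl, by linarith⟩
  have hright : a + s ∈ Set.Icc a (a + s) := ⟨by linarith, le_rfl⟩
  have hdist : ∀ u ∈ Set.Icc a (a + s), ‖x u - x a‖ ≤ M * s := fun u hu => by
    have h := (convex_Icc a (a + s)).norm_image_sub_le_of_norm_hasDerivWithin_le
      (fun y hy => (hx y (hsub hy)).hasDerivWithinAt) (fun y hy => hM y (hsub hy)) hleft hu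
    refine h.trans (mul_le_mul_of_nonneg_left ?_ hM0)
    rw [Real.norm_of_nonneg (by linarith [hu.1])]
    linarith [hu.2]
  have h := (convex_Icc a (a + s)).norm_image_sub_le_of_norm_hasDerivWithin_le
    (f := fun u => x u - u • v (x a)) (f' := fun u => v (x u) - v (x a)) (C := K * (M * s))
    (fun y hy => by
      simpa using ((hx y (hsub hy)).fun_sub ((hasDerivAt_id y).smul_const (v (x a)))).hasDerivWithinAt)
    (fun y hy => (hv.norm_sub_le _ _).trans
      (mul_le_mul_of_nonneg_left (hdist y hy) K.coe_nonneg)) hleft hright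
  have heq : x (a + s) - x a - s • v (x a)
      = (x (a + s) - (a + s) • v (x a)) - (x a - a • v (x a)) := by
    rw [add_smul]; abel
  rw [heq]
  refine h.trans_eq ?_
  rw [add_sub_cancel_left, Real.norm_of_nonneg hs]
  ring

/-- Propagation of the error bound `M * η * (exp (K * t) - 1)` along one Euler step. -/
lemma LipschitzWith.norm_sub_euler_step_le_exp (hv : LipschitzWith K v)
    (hx : ∀ t ∈ Set.Icc 0 T, HasDerivAt x (v (x t)) t)
    (hM : ∀ t ∈ Set.Icc 0 T, ‖v (x t)‖ ≤ M) {a s : ℝ} (ha : 0 ≤ a) (hs : 0 ≤ s)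
    (hsη : s ≤ η) (has : a + s ≤ T) {y : E}
    (hy : ‖x a - y‖ ≤ M * η * (Real.exp (K * a) - 1)) :
    ‖x (a + s) - (y + s • v y)‖ ≤ M * η * (Real.exp (K * (a + s)) - 1) := by
  have hM0 : 0 ≤ M := (norm_nonneg _).trans (hM a ⟨ha, by linarith⟩)
  have hK : (0 : ℝ) ≤ K := K.coe_nonneg
  have hη : 0 ≤ η := hs.trans hsη
  have heq : x (a + s) - (y + s • v y)
      = (x (a + s) - x a - s • v (x a)) + ((x a - y) + s • (v (x a) - v y)) := by
    rw [smul_sub]; abel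
  have hlip : ‖s • (v (x a) - v y)‖ ≤ s * (K * ‖x a - y‖) := by
    rw [norm_smul, Real.norm_of_nonneg hs]
    exact mul_le_mul_of_nonneg_left (hv.norm_sub_le _ _) hs
  calc ‖x (a + s) - (y + s • v y)‖
      ≤ K * M * s ^ 2 + (‖x a - y‖ + s * (K * ‖x a - y‖)) := by
        rw [heq]
        refine (norm_add_le _ _).trans (add_le_add
          (hv.norm_sub_euler_step_le hx hM ha hs has) ((norm_add_le _ _).trans ?_))
        gcongr
    _ = K * M * s * s + (1 + K * s) * ‖x a - y‖ := by ring
    _ ≤ K * M * s * η + (1 + K * s) * (M * η * (Real.exp (K * a) - 1)) := by gcongr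
    _ = M * η * (Real.exp (K * a) * (K * s + 1) - 1) := by ring
    _ ≤ M * η * (Real.exp (K * a) * Real.exp (K * s) - 1) := by
        gcongr
        exact Real.add_one_le_exp _
    _ = M * η * (Real.exp (K * (a + s)) - 1) := by rw [← Real.exp_add, mul_add]

/-- Global error of the Euler iterates. -/
lemma LipschitzWith.norm_sub_euler_iterate_le (hv : LipschitzWith K v)
    (hx : ∀ t ∈ Set.Icc 0 T, HasDerivAt x (v (x t)) t)
    (hM : ∀ t ∈ Set.Icc 0 T, ‖v (x t)‖ ≤ M) (hη : 0 ≤ η) {Y : ℕ → E} (hY0 : Y 0 = x 0)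
    (hY : ∀ k, Y (k + 1) = Y k + η • v (Y k)) (k : ℕ) (hk : k * η ≤ T) :
    ‖x (k * η) - Y k‖ ≤ M * η * (Real.exp (K * (k * η)) - 1) := by
  induction k with
  | zero => simp [hY0]
  | succ k ih =>
    have hstep : ((k + 1 : ℕ) : ℝ) * η = k * η + η := by push_cast; ring
    rw [hstep] at hk ⊢
    rw [hY]
    exact hv.norm_sub_euler_step_le_exp hx hM (by positivity) hη le_rfl hk (ih (by linarith))

/-- The piecewise linear Euler approximations converge pointwise to the solution. -/
lemma LipschitzWith.tendsto_euler (hv : LipschitzWith K v)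
    (hx : ∀ t ∈ Set.Ici (0 : ℝ), HasDerivAt x (v (x t)) t) {X : ℝ → ℕ → E}
    (hX0 : ∀ η, X η 0 = x 0) (hX : ∀ η k, X η (k + 1) = X η k + η • v (X η k))
    {t : ℝ} (ht : 0 ≤ t) :
    Filter.Tendsto
      (fun η : ℝ => X η ⌊t / η⌋₊ + (t - (⌊t / η⌋₊ : ℝ) * η) • v (X η ⌊t / η⌋₊))
      (nhdsWithin 0 (Set.Ioi 0)) (nhds (x t)) := by
  have hx' : ∀ u ∈ Set.Icc 0 t, HasDerivAt x (v (x u)) u := fun u hu => hx u hu.1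
  obtain ⟨M, hM⟩ := (isCompact_Icc (a := (0 : ℝ)) (b := t)).exists_bound_of_continuousOn
    (f := fun u => v (x u)) (hv.continuous.comp_continuousOn
      fun u hu => (hx' u hu).continuousAt.continuousWithinAt)
  have hlim : Filter.Tendsto (fun η : ℝ => M * η * (Real.exp (K * t) - 1))
      (nhdsWithin 0 (Set.Ioi 0)) (nhds 0) := by
    have hcont : Continuous fun η : ℝ => M * η * (Real.exp (K * t) - 1) := by fun_prop
    simpa using (hcont.tendsto 0).mono_left nhdsWithin_le_nhds
  rw [tendsto_iff_norm_sub_tendsto_zero]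
  refine squeeze_zero' (Filter.Eventually.of_forall fun _ => norm_nonneg _) ?_ hlim
  filter_upwards [self_mem_nhdsWithin] with η (hη : 0 < η)
  have hle : (⌊t / η⌋₊ : ℝ) * η ≤ t :=
    (le_div_iff₀ hη).1 (Nat.floor_le (div_nonneg ht hη.le))
  have hlt : t < ((⌊t / η⌋₊ : ℝ) + 1) * η := (div_lt_iff₀ hη).1 (Nat.lt_floor_add_one _)
  have h := hv.norm_sub_euler_step_le_exp hx' hM (a := (⌊t / η⌋₊ : ℝ) * η)
    (s := t - (⌊t / η⌋₊ : ℝ) * η) (by positivity) (by linarith) (η := η) (by linarith)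
    (by linarith)
    (hv.norm_sub_euler_iterate_le hx' hM hη.le (hX0 η) (hX η) ⌊t / η⌋₊ hle)
  rw [add_sub_cancel] at h
  rwa [norm_sub_rev]

end EulerMethod

/-- Pointwise convergence of function values of Euler's approximation: for a convex
`L`-smooth `f`, gradient flow solution `x`, and gradient descent iterates `X η`, we
have `f (x^(η) t) → f (x t)` as `η → 0⁺`, for every `t ≥ 0`. -/
theorem euler_approx_fun_values_tendsto
    {n : ℕ} (f : EuclideanSpace ℝ (Fin n) → ℝ) (L : ℝ) (hL : 0 < L)
    (hconv : ConvexOn ℝ Set.univ f) (hdiff : Differentiable ℝ f)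
    (hlip : LipschitzWith L.toNNReal (gradient f))
    (x₀ : EuclideanSpace ℝ (Fin n)) (x : ℝ → EuclideanSpace ℝ (Fin n))
    (hx0 : x 0 = x₀)
    (hflow : ∀ t ∈ Set.Ici (0 : ℝ), HasDerivAt x (-(gradient f (x t))) t)
    (X : ℝ → ℕ → EuclideanSpace ℝ (Fin n))
    (hX0 : ∀ η : ℝ, X η 0 = x₀)
    (hXs : ∀ (η : ℝ) (k : ℕ), X η (k + 1) = X η k - η • gradient f (X η k)) :
    ∀ t ∈ Set.Ici (0 : ℝ),
      Filter.Tendsto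
        (fun η : ℝ =>
          f (X η ⌊t / η⌋₊ - (t - (⌊t / η⌋₊ : ℝ) * η) • gradient f (X η ⌊t / η⌋₊)))
        (nhdsWithin 0 (Set.Ioi 0)) (nhds (f (x t))) := by
  intro t ht
  have hv : LipschitzWith L.toNNReal (fun y => -gradient f y) := hlip.neg
  have h := hv.tendsto_euler hflow (X := X) (fun η => (hX0 η).trans hx0.symm)
    (fun η k => by rw [hXs, smul_neg, sub_eq_add_neg]) ht
  simpa only [smul_neg, ← sub_eq_add_neg, Function.comp_def] using
    (hdiff.continuous.tendsto (x t)).comp h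
end
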